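/- arXiv:1911.11747 — 4 statements merged into one kernel-verified Lean document; each statement's English description precedes it below -/
import Mathlib

section
/- Rule X fails the O(log^c k)-core property for every c < 1: for every real c with 0 < c < 1 and every k₀, there exists an election instance (P,k) with k ≥ k₀ and a committee W that Rule X can output (under some tie-breaking) such that W is not in the λ-core for λ = (ln k)^c. -/
/-!
Common framework for approval-based committee elections
(Peters & Skowron, "Proportionality and the Limits of Welfarism").
-/

namespace ABC

/-- An election instance: a finite set `C` of candidates, a finite set `N` of voters,
an approval ballot `A i ⊆ C` for each voter `i`, and a committee size `k`. -/
structure Election where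
  C : Finset ℕ
  N : Finset ℕ
  A : ℕ → Finset ℕ
  k : ℕ

/-- Basic well-formedness of an election instance: ballots are sets of candidates,
`k ≤ |C|`, and the instance is nondegenerate (`k ≥ 1`, `n ≥ 1`). -/
def Election.Valid (E : Election) : Prop :=
  (∀ i ∈ E.N, E.A i ⊆ E.C) ∧ E.k ≤ E.C.card ∧ 0 < E.k ∧ 0 < E.N.card

/-- `C(P)`: the set of candidates approved by at least one voter. -/
def Election.CP (E : Election) : Finset ℕ := E.N.biUnion E.A

/-- The price `n/k`. -/
noncomputable def Election.price (E : Election) : ℝ := (E.N.card : ℝ) / (E.k : ℝ)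

/-- `N(c)`: the set of voters approving candidate `c`. -/
def Election.approvers (E : Election) (c : ℕ) : Finset ℕ :=
  E.N.filter (fun i => c ∈ E.A i)

/-- A committee: a set of at most `k` candidates. -/
def Election.IsCommittee (E : Election) (W : Finset ℕ) : Prop :=
  W ⊆ E.C ∧ W.card ≤ E.k

/-- The set of candidates approved by every voter in `S` (i.e. `⋂_{i ∈ S} A_i`). -/
def commonApproved (E : Election) (S : Finset ℕ) : Finset ℕ :=
  E.C.filter (fun c => ∀ i ∈ S, c ∈ E.A i)

/-! ### Price systems and priceability -/

/-- A price system: a positive price `p` and payment functions `pay i : C → [0,1]`,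
where voter `i` pays only for candidates she approves and spends at most one dollar. -/
structure PriceSystem (E : Election) where
  p : ℝ
  pay : ℕ → ℕ → ℝ
  p_pos : 0 < p
  pay_nonneg : ∀ i c, 0 ≤ pay i c
  pay_le_one : ∀ i c, pay i c ≤ 1
  pay_approved : ∀ i ∈ E.N, ∀ c : ℕ, 0 < pay i c → c ∈ E.A i
  pay_budget : ∀ i ∈ E.N, ∑ c ∈ E.C, pay i c ≤ 1

/-- The price system supports the committee `W`: every elected candidate receives
total payment `p`, unelected candidates receive nothing, and the supporters of an
unelected candidate have at most `p` unspent budget in total. -/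
def PriceSystem.SupportsW {E : Election} (ps : PriceSystem E) (W : Finset ℕ) : Prop :=
  (∀ c ∈ W, ∑ i ∈ E.N, ps.pay i c = ps.p) ∧
  (∀ c : ℕ, c ∉ W → ∑ i ∈ E.N, ps.pay i c = 0) ∧
  (∀ c ∈ E.C, c ∉ W →
    ∑ i ∈ E.approvers c, (1 - ∑ c' ∈ W, ps.pay i c') ≤ ps.p)

/-- A committee is priceable if some price system supports it. -/
def Priceable (E : Election) (W : Finset ℕ) : Prop :=
  ∃ ps : PriceSystem E, ps.SupportsW W

/-! ### Phragmén's sequential rule, via execution traces -/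

/-- An execution trace of Phragmén's sequential rule: `elected j` is the candidate
elected in step `j` (for `j < k`), at time `time j`; `reset j i` is the time at which
voter `i`'s balance was last reset before step `j` (so her balance at time `t` is
`t - reset j i`).  A candidate is elected at the first moment at which its approvers
jointly hold `n/k` dollars.  -/
structure PhragmenTrace (E : Election) where
  elected : ℕ → ℕ
  time : ℕ → ℝ
  reset : ℕ → ℕ → ℝ
  elected_mem : ∀ j < E.k, elected j ∈ E.C
  elected_inj : ∀ j < E.k, ∀ j' < E.k, elected j = elected j' → j = j'
  time_nonneg : ∀ j, 0 ≤ time j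
  time_mono : ∀ j j', j ≤ j' → time j ≤ time j'
  reset_zero : ∀ i, reset 0 i = 0
  reset_succ : ∀ j i, reset (j + 1) i = if elected j ∈ E.A i then time j else reset j i
  /-- the elected candidate's approvers jointly hold exactly `n/k` at the election time -/
  elect_eq : ∀ j < E.k, ∑ i ∈ E.approvers (elected j), (time j - reset j i) = E.price
  /-- no not-yet-elected candidate's approvers held more than `n/k` at any earlier moment -/
  first : ∀ j < E.k, ∀ c ∈ E.C, (∀ j' < j, elected j' ≠ c) →
    ∑ i ∈ E.approvers c, (time j - reset j i) ≤ E.price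

/-- `W` is a possible output of Phragmén's sequential rule (under some tie-breaking). -/
def PhragmenOutput (E : Election) (W : Finset ℕ) : Prop :=
  ∃ tr : PhragmenTrace E, W = (Finset.range E.k).image tr.elected

/-! ### Rule X -/

/-- Candidate `c` (not yet elected) is `q`-affordable given budgets `b`:
its approvers can raise `n/k` while each paying at most `q`. -/
def Affordable (E : Election) (b : ℕ → ℝ) (W : Finset ℕ) (c : ℕ) (q : ℝ) : Prop :=
  c ∈ E.C ∧ c ∉ W ∧ 0 ≤ q ∧ E.price ≤ ∑ i ∈ E.approvers c, min q (b i)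

/-- Reachable states of Rule X: starting from budgets all equal to `1` and the empty
committee, repeatedly add a candidate that is `q`-affordable for the minimum possible `q`
(ties broken arbitrarily), charging each approver `min q (b i)`. -/
inductive RuleXReach (E : Election) : (ℕ → ℝ) → Finset ℕ → Prop
  | init : RuleXReach E (fun _ => 1) ∅
  | step {b : ℕ → ℝ} {W : Finset ℕ} {c : ℕ} {q : ℝ} :
      RuleXReach E b W →
      Affordable E b W c q →
      (∀ c' q', Affordable E b W c' q' → q ≤ q') →
      RuleXReach E (fun i => if i ∈ E.approvers c then b i - min q (b i) else b i)
        (insert c W)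

/-- `W` is a possible output of Rule X (under some tie-breaking): a reachable
committee from which no further candidate is `q`-affordable for any `q`. -/
def RuleXOutput (E : Election) (W : Finset ℕ) : Prop :=
  ∃ b : ℕ → ℝ, RuleXReach E b W ∧ ∀ c q, ¬ Affordable E b W c q

/-! ### Proportional Approval Voting -/

/-- The harmonic number `H(t) = 1 + 1/2 + ⋯ + 1/t` (with `H(0) = 0`). -/
noncomputable def hsum (t : ℕ) : ℝ := ∑ j ∈ Finset.range t, (1 : ℝ) / (j + 1)

/-- The PAV score of a committee. -/
noncomputable def pavScore (E : Election) (W : Finset ℕ) : ℝ :=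
  ∑ i ∈ E.N, hsum ((E.A i ∩ W).card)

/-- `W` is a PAV winning committee: it has maximal PAV score among committees of size at
most `k`. -/
def PavWinner (E : Election) (W : Finset ℕ) : Prop :=
  W ⊆ E.C ∧ W.card ≤ E.k ∧
  ∀ W' : Finset ℕ, W' ⊆ E.C → W'.card ≤ E.k → pavScore E W' ≤ pavScore E W

/-! ### The core and its approximations -/

/-- `W` is in the core: no nonempty group `S` of voters together with a set `T` of
candidates with `|T|/k ≤ |S|/n` gives every member of `S` strictly more approved
candidates than `W` does. -/
def InCore (E : Election) (W : Finset ℕ) : Prop :=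
  ¬ ∃ S T : Finset ℕ, S ⊆ E.N ∧ S.Nonempty ∧ T ⊆ E.C ∧
    T.card * E.N.card ≤ S.card * E.k ∧
    ∀ i ∈ S, (E.A i ∩ W).card < (E.A i ∩ T).card

/-- `W` is in the `λ`-core: no nonempty group `S` and set `T` with `|T|/k ≤ |S|/n`
and `|A_i ∩ T| > max (λ·|A_i ∩ W|) 1` for every `i ∈ S`. -/
def InLamCore (lam : ℝ) (E : Election) (W : Finset ℕ) : Prop :=
  ¬ ∃ S T : Finset ℕ, S ⊆ E.N ∧ S.Nonempty ∧ T ⊆ E.C ∧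
    T.card * E.N.card ≤ S.card * E.k ∧
    ∀ i ∈ S, max (lam * ((E.A i ∩ W).card : ℝ)) 1 < ((E.A i ∩ T).card : ℝ)

/-! ### Pigou–Dalton transfers -/

/-- `W` admits a Pigou–Dalton transfer: there is a committee `W'` of the same size and
voters `i, j` with `|A_j∩W| > |A_i∩W|` such that all other voters' utilities are
unchanged in `W'`, the combined utility of `i` and `j` is unchanged, and
`|A_j∩W| > |A_j∩W'| ≥ |A_i∩W'| > |A_i∩W|`. -/
def AdmitsPD (E : Election) (W : Finset ℕ) : Prop :=
  ∃ W' : Finset ℕ, W' ⊆ E.C ∧ W'.card = W.card ∧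
  ∃ i ∈ E.N, ∃ j ∈ E.N, i ≠ j ∧
    (E.A i ∩ W).card < (E.A j ∩ W).card ∧
    (∀ l ∈ E.N, l ≠ i → l ≠ j → (E.A l ∩ W').card = (E.A l ∩ W).card) ∧
    (E.A i ∩ W').card + (E.A j ∩ W').card = (E.A i ∩ W).card + (E.A j ∩ W).card ∧
    (E.A j ∩ W').card < (E.A j ∩ W).card ∧
    (E.A i ∩ W').card ≤ (E.A j ∩ W').card ∧
    (E.A i ∩ W).card < (E.A i ∩ W').card

/-! ### Laminar instances and laminar proportionality -/

/-- All ballots are equal. -/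
def Unanimous (E : Election) : Prop := ∀ i ∈ E.N, ∀ j ∈ E.N, E.A i = E.A j

/-- `P₋c`: remove candidate `c` from every ballot; the committee size drops by one. -/
def eraseCand (E : Election) (c : ℕ) : Election :=
  { C := E.C.erase c, N := E.N, A := fun i => (E.A i).erase c, k := E.k - 1 }

/-- `E` is the concatenation of two instances `E₁`, `E₂` on disjoint voter sets and
disjoint candidate sets, with `k = k₁ + k₂` and `n₁/k₁ = n₂/k₂`. -/
def Combines (E E₁ E₂ : Election) : Prop :=
  Disjoint E₁.N E₂.N ∧ Disjoint E₁.CP E₂.CP ∧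
  E.N = E₁.N ∪ E₂.N ∧
  (∀ i ∈ E₁.N, E.A i = E₁.A i) ∧ (∀ i ∈ E₂.N, E.A i = E₂.A i) ∧
  E.k = E₁.k + E₂.k ∧ 0 < E₁.k ∧ 0 < E₂.k ∧
  E₁.N.card * E₂.k = E₂.N.card * E₁.k

/-- Laminar election instances. -/
inductive Laminar : Election → Prop
  | unanimous (E : Election) : Unanimous E → E.k ≤ E.CP.card → Laminar E
  | consensus (E : Election) (c : ℕ) : 0 < E.k → c ∈ E.CP →
      (∀ i ∈ E.N, c ∈ E.A i) →
      ¬ Unanimous (eraseCand E c) → Laminar (eraseCand E c) → Laminar E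
  | combine (E E₁ E₂ : Election) : Combines E E₁ E₂ →
      Laminar E₁ → Laminar E₂ → Laminar E

/-- Laminar proportional committees for a laminar instance. -/
inductive LamProp : Election → Finset ℕ → Prop
  | unanimous (E : Election) (W : Finset ℕ) :
      Unanimous E → W ⊆ E.CP → W.card = E.k → LamProp E W
  | consensus (E : Election) (c : ℕ) (W' : Finset ℕ) : 0 < E.k → c ∈ E.CP →
      (∀ i ∈ E.N, c ∈ E.A i) → Laminar (eraseCand E c) →
      LamProp (eraseCand E c) W' → c ∉ W' → LamProp E (insert c W')
  | combine (E E₁ E₂ : Election) (W₁ W₂ : Finset ℕ) : Combines E E₁ E₂ →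
      LamProp E₁ W₁ → LamProp E₂ W₂ → LamProp E (W₁ ∪ W₂)

/-! ### Committee rules and welfarism -/

/-- The welfare vector of `W`: each voter's number of approved committee members
(indexed by voter name, `0` outside `N`). -/
def wvec (E : Election) (W : Finset ℕ) : ℕ → ℕ :=
  fun i => if i ∈ E.N then (E.A i ∩ W).card else 0

/-- A committee rule returns, on every (valid) instance, a nonempty set of committees
of size at most `k`. -/
def CommitteeRule (f : Election → Set (Finset ℕ)) : Prop :=
  ∀ E : Election, E.Valid → (f E).Nonempty ∧ ∀ W ∈ f E, W ⊆ E.C ∧ W.card ≤ E.k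

/-- A rule is welfarist if for each committee size `k` there is a function `g k` of the
welfare vector such that on every instance the rule returns exactly the size-`k`
committees maximizing `g k` of their welfare vector. -/
def Welfarist (f : Election → Set (Finset ℕ)) : Prop :=
  ∃ g : ℕ → (ℕ → ℕ) → ℝ, ∀ E : Election, E.Valid →
    f E = { W : Finset ℕ | W ⊆ E.C ∧ W.card = E.k ∧
      ∀ W' : Finset ℕ, W' ⊆ E.C → W'.card = E.k →
        g E.k (wvec E W') ≤ g E.k (wvec E W) }

/-- Pareto-optimality of a rule. -/
def ParetoOptimal (f : Election → Set (Finset ℕ)) : Prop :=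
  ∀ E : Election, E.Valid → ∀ W ∈ f E,
    ¬ ∃ W' : Finset ℕ, W' ⊆ E.C ∧ W'.card ≤ E.k ∧
      (∀ i ∈ E.N, (E.A i ∩ W).card ≤ (E.A i ∩ W').card) ∧
      (∃ i ∈ E.N, (E.A i ∩ W).card < (E.A i ∩ W').card)

/-! ### Party-list profiles -/

/-- A party-list profile: any two ballots are equal or disjoint. -/
def PartyList (E : Election) : Prop :=
  ∀ i ∈ E.N, ∀ j ∈ E.N, E.A i = E.A j ∨ Disjoint (E.A i) (E.A j)

/-- The number of voters supporting the party with ballot `B`. -/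
def nParty (E : Election) (B : Finset ℕ) : ℕ :=
  (E.N.filter (fun i => E.A i = B)).card

/-! ### Priceability with equal payments -/

/-- `T` is priceable with equal payments in the instance restricted to the voters in `S`
with committee size `|T|`: payments are in `[0,1]`, only for approved candidates,
each voter spends at most `1` on `T`, every `c ∈ T` receives exactly `|S|/|T|` in total,
and all voters paying for `c` pay the same amount. -/
def PriceableEq (E : Election) (S T : Finset ℕ) : Prop :=
  ∃ pay : ℕ → ℕ → ℝ,
    (∀ i c, 0 ≤ pay i c ∧ pay i c ≤ 1) ∧
    (∀ i ∈ S, ∀ c : ℕ, 0 < pay i c → c ∈ E.A i) ∧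
    (∀ i ∈ S, ∑ c ∈ T, pay i c ≤ 1) ∧
    (∀ c ∈ T, ∑ i ∈ S, pay i c = (S.card : ℝ) / (T.card : ℝ)) ∧
    (∀ c ∈ T, ∀ i ∈ S, ∀ j ∈ S, c ∈ E.A i → c ∈ E.A j → pay i c = pay j c)


/-! ### An instance on which Rule X is far from the core

The voters come in `L` levels of `L * 2 ^ L` voters each; the level of voter `i` is
`i / (L * 2 ^ L)`.  The candidates below `L * 2 ^ L` form the deviation: candidate `t` is approved
by a `2 ^ (a + 1)`-th of the voters of each level `a`.  The other candidates are the ones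
that Rule X elects, in increasing order: each of them is approved by a `2 ^ a`-th of the voters
of a single level `a`. -/

/-- The committee size of the instance with `L` levels. -/
def levelSize (L : ℕ) : ℕ := L * 2 ^ L

/-- The instance with `L` levels of voters. -/
def levelElection (L : ℕ) : Election where
  C := Finset.range (levelSize L + levelSize L)
  N := Finset.range (L * levelSize L)
  A i := (Finset.range (levelSize L + levelSize L)).filter fun d =>
    if d < levelSize L then i ≡ d [MOD 2 ^ (i / levelSize L + 1)]
    else (d - levelSize L) / 2 ^ L = i / levelSize L ∧
      i ≡ d - levelSize L [MOD 2 ^ (i / levelSize L)]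
  k := levelSize L

/-- The budget of voter `i` once the candidates in `[levelSize L, levelSize L + e)` are elected. -/
noncomputable def levelBudget (L e i : ℕ) : ℝ :=
  1 - (((levelElection L).A i ∩ Finset.Ico (levelSize L) (levelSize L + e)).card : ℝ) *
    (2 ^ (i / levelSize L) / 2 ^ L)

theorem card_filter_modEq_Ico {m r : ℕ} (hr : 0 < r) (hm : r ∣ m) (s v : ℕ) :
    ((Finset.Ico s (s + m)).filter (fun i => i ≡ v [MOD r])).card = m / r := by
  have hper : Function.Periodic (fun i => i ≡ v [MOD r]) m := by
    intro i
    obtain ⟨t, rfl⟩ := hm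
    simp [Nat.ModEq]
  rw [Nat.filter_Ico_card_eq_of_periodic _ _ _ hper, Nat.count_modEq_card _ hr,
    Nat.mod_eq_zero_of_dvd hm]
  simp

theorem card_filter_modEq_Ico' {m r : ℕ} (hr : 0 < r) (hm : r ∣ m) (s v : ℕ) :
    ((Finset.Ico s (s + m)).filter (fun i => v ≡ i [MOD r])).card = m / r := by
  rw [← card_filter_modEq_Ico hr hm s v]
  simp only [Nat.ModEq.comm]

theorem levelSize_pos {L : ℕ} (hL : 0 < L) : 0 < levelSize L :=
  Nat.mul_pos hL (by positivity)

theorem pow_dvd_levelSize {L a : ℕ} (ha : a ≤ L) : 2 ^ a ∣ levelSize L :=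
  (pow_dvd_pow 2 ha).mul_left L

theorem levelSize_div_pow {L a : ℕ} (ha : a ≤ L) : levelSize L / 2 ^ a = L * 2 ^ (L - a) := by
  rw [levelSize, Nat.mul_div_assoc _ (pow_dvd_pow 2 ha), Nat.pow_div ha (by norm_num)]

theorem mem_ballot_low {L i d : ℕ} (hd : d < levelSize L) :
    d ∈ (levelElection L).A i ↔ i ≡ d [MOD 2 ^ (i / levelSize L + 1)] := by
  simp only [levelElection, Finset.mem_filter, Finset.mem_range, if_pos hd]
  exact and_iff_right (by omega)

theorem mem_ballot_high {L i e : ℕ} (he : e < levelSize L) :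
    levelSize L + e ∈ (levelElection L).A i ↔
      e / 2 ^ L = i / levelSize L ∧ i ≡ e [MOD 2 ^ (i / levelSize L)] := by
  simp [levelElection, he]

theorem level_lt {L i : ℕ} (hi : i ∈ (levelElection L).N) : i / levelSize L < L := by
  rw [levelElection, Finset.mem_range] at hi
  exact Nat.div_lt_of_lt_mul (by rwa [mul_comm])

theorem index_level_lt {L e : ℕ} (he : e < levelSize L) : e / 2 ^ L < L :=
  Nat.div_lt_of_lt_mul (by rwa [mul_comm])

theorem mem_voters_iff {L i : ℕ} (hL : 0 < L) :
    i ∈ (levelElection L).N ↔ i / levelSize L < L := by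
  rw [levelElection, Finset.mem_range, Nat.div_lt_iff_lt_mul (levelSize_pos hL)]

theorem level_eq_iff {L i a : ℕ} (hL : 0 < L) :
    i / levelSize L = a ↔
      i ∈ Finset.Ico (a * levelSize L) (a * levelSize L + levelSize L) := by
  rw [Nat.div_eq_iff (levelSize_pos hL), Finset.mem_Ico]
  have := levelSize_pos hL
  omega

theorem price_levelElection {L : ℕ} (hL : 0 < L) : (levelElection L).price = L := by
  have : (levelSize L : ℝ) ≠ 0 := by exact_mod_cast (levelSize_pos hL).ne'
  simp only [Election.price, levelElection, Finset.card_range, Nat.cast_mul]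
  field_simp

/-- The number of voters of level `a` approving a candidate of the deviation. -/
theorem card_approvers_low_level {L t a : ℕ} (hL : 0 < L) (ht : t < levelSize L) (ha : a < L) :
    (((levelElection L).approvers t).filter (fun i => i / levelSize L = a)).card =
      L * 2 ^ (L - (a + 1)) := by
  rw [← levelSize_div_pow ha,
    ← card_filter_modEq_Ico (by positivity) (pow_dvd_levelSize ha) (a * levelSize L) t]
  congr 1
  ext i
  simp only [Election.approvers, Finset.mem_filter, mem_ballot_low ht, mem_voters_iff hL,
    ← level_eq_iff hL]
  grind

theorem card_approvers_low {L t a : ℕ} (hL : 0 < L) (ht : t < levelSize L) (ha : a ≤ L) :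
    (((levelElection L).approvers t).filter (fun i => a ≤ i / levelSize L)).card ≤
      L * 2 ^ (L - a) := by
  induction ha using Nat.decreasingInduction with
  | self =>
    rw [Finset.filter_eq_empty_iff.2]
    · simp
    · intro i hi
      exact (level_lt (Finset.mem_filter.1 hi).1).not_ge
  | of_succ a ha ih =>
    have hsplit : ((levelElection L).approvers t).filter (fun i => a ≤ i / levelSize L) =
        ((levelElection L).approvers t).filter (fun i => i / levelSize L = a) ∪
        ((levelElection L).approvers t).filter (fun i => a + 1 ≤ i / levelSize L) := by
      rw [← Finset.filter_or]
      refine Finset.filter_congr fun i _ => ?_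
      omega
    rw [hsplit]
    refine (Finset.card_union_le _ _).trans ?_
    rw [card_approvers_low_level hL ht ha]
    have : L - a = (L - (a + 1)) + 1 := by omega
    rw [this, pow_succ]
    linarith

theorem card_approvers_high {L e : ℕ} (hL : 0 < L) (he : e < levelSize L) :
    ((levelElection L).approvers (levelSize L + e)).card = L * 2 ^ (L - e / 2 ^ L) := by
  have ha := index_level_lt he
  rw [← levelSize_div_pow ha.le, ← card_filter_modEq_Ico (by positivity)
    (pow_dvd_levelSize ha.le) (e / 2 ^ L * levelSize L) e]
  congr 1
  ext i
  simp only [Election.approvers, Finset.mem_filter, mem_ballot_high he, mem_voters_iff hL,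
    ← level_eq_iff hL]
  grind

/-- The utility of a voter from the deviation. -/
theorem card_ballot_low {L i : ℕ} (hi : i / levelSize L < L) :
    ((levelElection L).A i ∩ Finset.range (levelSize L)).card =
      L * 2 ^ (L - (i / levelSize L + 1)) := by
  rw [← levelSize_div_pow hi,
    ← card_filter_modEq_Ico' (by positivity) (pow_dvd_levelSize hi) 0 i]
  congr 1
  ext d
  simp only [Finset.mem_inter, Finset.mem_range, Finset.mem_filter, Finset.mem_Ico]
  constructor
  · rintro ⟨h, hd⟩
    exact ⟨⟨by omega, by omega⟩, (mem_ballot_low hd).1 h⟩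
  · rintro ⟨⟨-, hd⟩, h⟩
    exact ⟨(mem_ballot_low (by omega)).2 h, by omega⟩

/-- The utility of a voter from the candidates elected by Rule X, once those of the voter's level
are elected. -/
theorem card_ballot_high {L i e : ℕ} (hi : i / levelSize L < L) (he : e ≤ levelSize L)
    (hie : i / levelSize L * 2 ^ L + 2 ^ L ≤ e) :
    ((levelElection L).A i ∩ Finset.Ico (levelSize L) (levelSize L + e)).card =
      2 ^ (L - i / levelSize L) := by
  rw [← Nat.pow_div hi.le (by norm_num), ← card_filter_modEq_Ico' (by positivity)
    (pow_dvd_pow 2 hi.le) (i / levelSize L * 2 ^ L) i]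
  symm
  refine Finset.card_bij (fun d _ => levelSize L + d) ?_ (by simp) ?_
  · intro d hd
    rw [Finset.mem_filter, Finset.mem_Ico] at hd
    rw [Finset.mem_inter, Finset.mem_Ico, mem_ballot_high (by omega), Nat.div_eq_iff (by positivity)]
    refine ⟨⟨?_, hd.2⟩, by omega⟩
    omega
  · intro d hd
    rw [Finset.mem_inter, Finset.mem_Ico] at hd
    obtain ⟨hd, h1, h2⟩ := hd
    obtain ⟨d, rfl⟩ := Nat.exists_eq_add_of_le h1
    rw [mem_ballot_high (by omega), Nat.div_eq_iff (by positivity)] at hd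
    have : 0 < 2 ^ L := by positivity
    exact ⟨d, Finset.mem_filter.2 ⟨Finset.mem_Ico.2 (by omega), hd.2⟩, rfl⟩

theorem levelBudget_exhausted {L i e : ℕ} (hi : i / levelSize L < L) (he : e ≤ levelSize L)
    (hie : i / levelSize L * 2 ^ L + 2 ^ L ≤ e) : levelBudget L e i = 0 := by
  rw [levelBudget, card_ballot_high hi he hie]
  push_cast
  rw [← mul_div_assoc, ← pow_add, Nat.sub_add_cancel hi.le, div_self (by positivity), sub_self]

theorem insert_Ico_levelSize (L e : ℕ) :
    insert (levelSize L + e) (Finset.Ico (levelSize L) (levelSize L + e)) =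
      Finset.Ico (levelSize L) (levelSize L + (e + 1)) := by
  rw [← add_assoc, Finset.insert_Ico_right_eq_Ico_add_one (by omega)]

theorem levelBudget_succ {L i e : ℕ} :
    levelBudget L (e + 1) i = if levelSize L + e ∈ (levelElection L).A i
      then levelBudget L e i - 2 ^ (i / levelSize L) / 2 ^ L else levelBudget L e i := by
  unfold levelBudget
  rw [← insert_Ico_levelSize]
  split_ifs with h
  · rw [Finset.inter_insert_of_mem h, Finset.card_insert_of_notMem (by simp)]
    push_cast
    ring
  · rw [Finset.inter_insert_of_notMem h]

theorem levelBudget_antitone (L i : ℕ) : Antitone fun e => levelBudget L e i := by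
  refine antitone_nat_of_succ_le fun e => ?_
  rw [levelBudget_succ]
  split_ifs
  · have : (0 : ℝ) ≤ 2 ^ (i / levelSize L) / 2 ^ L := by positivity
    linarith
  · exact le_rfl

theorem le_levelBudget {L i e : ℕ} (he : e < levelSize L)
    (hi : levelSize L + e ∈ (levelElection L).A i) :
    (2 : ℝ) ^ (i / levelSize L) / 2 ^ L ≤ levelBudget L e i := by
  have hlev : i / levelSize L < L := by
    rw [← ((mem_ballot_high he).1 hi).1]
    exact index_level_lt he
  have hz : levelBudget L (levelSize L) i = 0 := by
    refine levelBudget_exhausted hlev le_rfl ?_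
    rw [← Nat.succ_mul]
    exact Nat.mul_le_mul_right _ hlev
  have hle : levelBudget L (levelSize L) i ≤ levelBudget L (e + 1) i :=
    levelBudget_antitone L i he
  rw [hz, levelBudget_succ, if_pos hi] at hle
  linarith

/-- While a candidate of level `a` is about to be elected, the money that the approvers of an
unelected candidate can raise with payments of at most `q`. -/
theorem sum_min_levelBudget_le {L e c : ℕ} {q : ℝ} (hL : 0 < L) (he : e < levelSize L)
    (hc : c ∈ (levelElection L).C) (hcW : c ∉ Finset.Ico (levelSize L) (levelSize L + e))
    (hq : 0 ≤ q) :
    ∑ i ∈ (levelElection L).approvers c, min q (levelBudget L e i) ≤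
      (L * 2 ^ (L - e / 2 ^ L) : ℕ) * q := by
  have ha := index_level_lt he
  rw [levelElection, Finset.mem_range] at hc
  rcases lt_or_ge c (levelSize L) with hlow | hhigh
  · calc ∑ i ∈ (levelElection L).approvers c, min q (levelBudget L e i)
        ≤ ∑ i ∈ (levelElection L).approvers c,
            if e / 2 ^ L ≤ i / levelSize L then q else 0 := by
          refine Finset.sum_le_sum fun i hi => ?_
          split_ifs with h
          · exact min_le_left _ _
          · refine (min_le_right _ _).trans
              (levelBudget_exhausted (level_lt (Finset.mem_filter.1 hi).1) he.le ?_).le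
            rw [← Nat.succ_mul]
            exact (Nat.mul_le_mul_right _ (by omega)).trans (Nat.div_mul_le_self e (2 ^ L))
      _ = (((levelElection L).approvers c).filter
            (fun i => e / 2 ^ L ≤ i / levelSize L)).card * q := by
          rw [← Finset.sum_filter, Finset.sum_const, nsmul_eq_mul]
      _ ≤ _ := by
          gcongr
          exact card_approvers_low hL hlow ha.le
  · obtain ⟨d, rfl⟩ := Nat.exists_eq_add_of_le hhigh
    have hed : e ≤ d := by
      rw [Finset.mem_Ico] at hcW
      omega
    calc ∑ i ∈ (levelElection L).approvers (levelSize L + d), min q (levelBudget L e i)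
        ≤ ∑ i ∈ (levelElection L).approvers (levelSize L + d), q :=
          Finset.sum_le_sum fun i _ => min_le_left _ _
      _ = (L * 2 ^ (L - d / 2 ^ L) : ℕ) * q := by
          rw [Finset.sum_const, nsmul_eq_mul, card_approvers_high hL (by omega)]
      _ ≤ _ := by
          gcongr
          norm_num

theorem cast_mul_pow_mul_level {L a : ℕ} (ha : a ≤ L) :
    ((L * 2 ^ (L - a) : ℕ) : ℝ) * (2 ^ a / 2 ^ L) = L := by
  push_cast
  rw [mul_assoc, ← mul_div_assoc, ← pow_add, Nat.sub_add_cancel ha, div_self (by positivity),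
    mul_one]

theorem ruleXReach_levelElection {L e : ℕ} (hL : 0 < L) (he : e ≤ levelSize L) :
    RuleXReach (levelElection L) (levelBudget L e)
      (Finset.Ico (levelSize L) (levelSize L + e)) := by
  induction e with
  | zero =>
    have : levelBudget L 0 = fun _ => 1 := by
      ext i
      simp [levelBudget]
    rw [this, add_zero, Finset.Ico_self]
    exact .init
  | succ e ih =>
    have ha := index_level_lt he
    have hmin : ∀ i ∈ (levelElection L).approvers (levelSize L + e),
        min ((2 : ℝ) ^ (e / 2 ^ L) / 2 ^ L) (levelBudget L e i) =
          2 ^ (e / 2 ^ L) / 2 ^ L := by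
      intro i hi
      have hi' := (Finset.mem_filter.1 hi).2
      refine min_eq_left ?_
      rw [((mem_ballot_high he).1 hi').1]
      exact le_levelBudget he hi'
    have hafford : Affordable (levelElection L) (levelBudget L e)
        (Finset.Ico (levelSize L) (levelSize L + e)) (levelSize L + e)
        (2 ^ (e / 2 ^ L) / 2 ^ L) := by
      refine ⟨?_, by simp, by positivity, ?_⟩
      · rw [levelElection, Finset.mem_range]
        omega
      · rw [Finset.sum_congr rfl hmin, Finset.sum_const, nsmul_eq_mul,
          card_approvers_high hL he, cast_mul_pow_mul_level ha.le, price_levelElection hL]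
    have hstep := RuleXReach.step (ih (by omega)) hafford (by
      rintro c q ⟨hc, hcW, hq, hprice⟩
      have h := hprice.trans (sum_min_levelBudget_le hL he hc hcW hq)
      rw [price_levelElection hL, ← cast_mul_pow_mul_level ha.le] at h
      exact le_of_mul_le_mul_left h (by positivity))
    rw [insert_Ico_levelSize] at hstep
    convert hstep using 1
    ext i
    rw [levelBudget_succ]
    have hiff : i ∈ (levelElection L).approvers (levelSize L + e) ↔
        levelSize L + e ∈ (levelElection L).A i := by
      refine ⟨fun h => (Finset.mem_filter.1 h).2, fun h => Finset.mem_filter.2 ⟨?_, h⟩⟩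
      rw [mem_voters_iff hL, ← ((mem_ballot_high he).1 h).1]
      exact ha
    simp only [← hiff]
    split_ifs with h
    · rw [hmin i h, ((mem_ballot_high he).1 (hiff.1 h)).1]
    · rfl

theorem level_mul_pow_add_le {L a : ℕ} (ha : a < L) : a * 2 ^ L + 2 ^ L ≤ levelSize L := by
  rw [← Nat.succ_mul]
  exact Nat.mul_le_mul_right _ ha

theorem ruleXOutput_levelElection {L : ℕ} (hL : 0 < L) :
    RuleXOutput (levelElection L) (Finset.Ico (levelSize L) (levelSize L + levelSize L)) := by
  refine ⟨_, ruleXReach_levelElection hL le_rfl, ?_⟩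
  rintro c q ⟨-, -, -, hprice⟩
  have hsum : ∑ i ∈ (levelElection L).approvers c, min q (levelBudget L (levelSize L) i) ≤ 0 :=
    Finset.sum_nonpos fun i hi => by
      have hi := level_lt (Finset.mem_filter.1 hi).1
      exact (min_le_right _ _).trans
        (levelBudget_exhausted hi le_rfl (level_mul_pow_add_le hi)).le
  rw [price_levelElection hL] at hprice
  have : (0 : ℝ) < L := by exact_mod_cast hL
  linarith

theorem valid_levelElection {L : ℕ} (hL : 0 < L) : (levelElection L).Valid := by
  have := levelSize_pos hL
  refine ⟨fun i _ => Finset.filter_subset _ _, ?_, this, ?_⟩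
  · simp [levelElection]
  · simpa [levelElection] using ⟨hL, this⟩

theorem not_inLamCore_levelElection {L : ℕ} (hL : 2 ≤ L) {lam : ℝ} (hlam : 2 * lam < L) :
    ¬ InLamCore lam (levelElection L)
      (Finset.Ico (levelSize L) (levelSize L + levelSize L)) := by
  have hL0 : 0 < L := by omega
  have hM := levelSize_pos hL0
  rw [InLamCore, not_not]
  refine ⟨(levelElection L).N, Finset.range (levelSize L), subset_rfl, ?_, ?_, ?_, ?_⟩
  · exact Finset.card_pos.1 (valid_levelElection hL0).2.2.2
  · exact Finset.range_subset_range.2 (by omega)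
  · simp [levelElection, mul_comm]
  · intro i hi
    have hi := level_lt hi
    rw [card_ballot_low hi, card_ballot_high hi le_rfl (level_mul_pow_add_le hi)]
    have hsub : L - i / levelSize L = (L - (i / levelSize L + 1)) + 1 := by omega
    rw [hsub]
    set x := L - (i / levelSize L + 1)
    have hx : (1 : ℝ) ≤ 2 ^ x := one_le_pow₀ (by norm_num)
    have hL' : (2 : ℝ) ≤ L := by exact_mod_cast hL
    push_cast
    refine max_lt ?_ (by nlinarith)
    rw [pow_succ]
    nlinarith

theorem log_levelSize_le {L : ℕ} (hL : 0 < L) : Real.log (levelSize L : ℝ) ≤ 2 * L := by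
  have hL' : (0 : ℝ) < L := by exact_mod_cast hL
  rw [levelSize]
  push_cast
  rw [Real.log_mul hL'.ne' (by positivity), Real.log_pow]
  have h1 := Real.log_le_sub_one_of_pos hL'
  have h2 := Real.log_le_sub_one_of_pos (zero_lt_two' ℝ)
  nlinarith

theorem eventually_two_mul_rpow_lt {c : ℝ} (hc1 : c < 1) :
    ∀ᶠ L : ℕ in Filter.atTop, 2 * (2 * (L : ℝ)) ^ c < L := by
  have h := ((tendsto_rpow_atTop (sub_pos.2 hc1)).comp
    tendsto_natCast_atTop_atTop).eventually_gt_atTop (2 * (2 : ℝ) ^ c)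
  filter_upwards [h, Filter.eventually_gt_atTop 0] with L hL hpos
  have hpos' : (0 : ℝ) < L := by exact_mod_cast hpos
  rw [Function.comp_apply, Real.rpow_sub hpos', Real.rpow_one,
    lt_div_iff₀ (Real.rpow_pos_of_pos hpos' c)] at hL
  rwa [Real.mul_rpow zero_le_two hpos'.le, ← mul_assoc]

/-- Rule X fails the `O(log^c k)`-core property for every `c < 1`:
for every `0 < c < 1` and every `k₀` there is an instance with `k ≥ k₀` and a
committee that Rule X can output which is not in the `(ln k)^c`-core. -/
theorem ruleX_fails_polylog_core (c : ℝ) (hc0 : 0 < c) (hc1 : c < 1) (k₀ : ℕ) :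
    ∃ (E : Election) (W : Finset ℕ), E.Valid ∧ k₀ ≤ E.k ∧ RuleXOutput E W ∧
      ¬ InLamCore ((Real.log (E.k : ℝ)) ^ c) E W := by
  obtain ⟨L, hlt, hL2, hLk⟩ := ((eventually_two_mul_rpow_lt hc1).and
    ((Filter.eventually_ge_atTop 2).and (Filter.eventually_ge_atTop k₀))).exists
  have hL : 0 < L := by omega
  refine ⟨levelElection L, _, valid_levelElection hL,
    hLk.trans (Nat.le_mul_of_pos_right L (by positivity)), ruleXOutput_levelElection hL,
    not_inLamCore_levelElection hL2 (lt_of_le_of_lt ?_ hlt)⟩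
  exact mul_le_mul_of_nonneg_left (Real.rpow_le_rpow (Real.log_natCast_nonneg _)
    (log_levelSize_le hL) hc0.le) zero_le_two

end ABC
end

section
/- Rule X violates the core subject to priceability: there exist an election instance (P,k), a committee W that Rule X can output (under some tie-breaking), and a pair (S,T) with S ⊆ N and T ⊆ C such that |T| ≤ k·|S|/n, |A_i∩T| > |A_i∩W| for every i ∈ S, and T is priceable in the restricted instance (P|_S, |T|). In particular, this holds for the instance with 160 voters partitioned into V_1, V_2, V_3 of sizes 56, 56, 48, committee size k = 20, and candidate sets C_1 (20 candidates) and C_2 (16 candidates) as constructed in the paper, where Rule X outputs C_1 and C_2 is a priceable deviation for V_1' ∪ V_2' ∪ V_3. -/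
/-!
Common framework for approval-based committee elections
(Peters & Skowron, "Proportionality and the Limits of Welfarism").
-/

namespace ABC

/-! ### The instance

The 160 voters form 20 blocks of 8 identical voters, voter `i` belonging to block `i / 8`.
Blocks `0`–`6`, `7`–`13` and `14`–`19` make up `V₁`, `V₂` and `V₃`; the deviating parts of
`V₁` and `V₂` are the blocks `0`–`4` and `7`–`11`.  Candidates `0`–`19` form `C₁`, in the order
in which Rule X elects them, and candidates `20`–`35` form `C₂`. -/

/-- Block `g` approves candidate `c`. -/
def BlockApproves (c g : ℕ) : Prop :=
  if c < 12 then
    g = 5 ∨ g = 6 ∨ (12 ≤ g ∧ g < 20) ∨ g = c % 5 ∨ g = 7 + c % 5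
  else if c < 20 then
    if c % 2 = 0 then g < 5 else 7 ≤ g ∧ g < 12
  else
    (14 ≤ g ∧ g < 20) ∨ if c < 28 then g < 5 else 7 ≤ g ∧ g < 12

instance (c g : ℕ) : Decidable (BlockApproves c g) := by
  unfold BlockApproves; infer_instance

/-- The maximal payment, in units of `1/60`, at which Rule X elects candidate `t`. -/
def blockPayment (t : ℕ) : ℕ := if t < 12 then 5 else if t < 18 then 12 else 14

/-- The budget, in units of `1/60`, of a voter in block `g` once Rule X has elected
the candidates below `t`. -/
def blockBudget : ℕ → ℕ → ℕ
  | 0, _ => 60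
  | t + 1, g =>
    if BlockApproves t g then blockBudget t g - min (blockPayment t) (blockBudget t g)
    else blockBudget t g

/-- The payment, in units of `1/16`, of a voter in block `g` for candidate `c` in the
price system supporting `C₂`. -/
def deviationPayment (g c : ℕ) : ℕ :=
  if 20 ≤ c ∧ c < 36 ∧ BlockApproves c g then (if 14 ≤ g then 1 else 2) else 0

/-- The election with 160 voters in 20 blocks of size 8. -/
def blockElection : Election where
  C := Finset.range 36
  N := Finset.range 160
  A := fun i => (Finset.range 36).filter (fun c => BlockApproves c (i / 8))
  k := 20

lemma sum_range_mul_div (f : ℕ → ℝ) {d : ℕ} (hd : 0 < d) (m : ℕ) :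
    ∑ i ∈ Finset.range (m * d), f (i / d) = d * ∑ g ∈ Finset.range m, f g := by
  induction m with
  | zero => simp
  | succ m ih =>
    rw [Nat.succ_mul, Finset.sum_range_add, ih, Finset.sum_range_succ, mul_add]
    congr 1
    rw [Finset.sum_congr rfl (g := fun _ => f m), Finset.sum_const, Finset.card_range,
      nsmul_eq_mul]
    intro j hj
    rw [Nat.add_comm, Nat.add_mul_div_right _ _ hd, Nat.div_eq_of_lt (Finset.mem_range.1 hj),
      Nat.zero_add]

lemma blockElection_price : blockElection.price = 8 := by
  norm_num [Election.price, blockElection]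

lemma mem_blockElection_approvers {c i : ℕ} :
    i ∈ blockElection.approvers c ↔ i < 160 ∧ c < 36 ∧ BlockApproves c (i / 8) := by
  simp [Election.approvers, blockElection]

lemma blockElection_approvers {c : ℕ} (hc : c < 36) :
    blockElection.approvers c =
      (Finset.range (20 * 8)).filter (fun i => BlockApproves c (i / 8)) := by
  ext i
  simp [mem_blockElection_approvers, hc]

lemma BlockApproves.lt {c g : ℕ} (h : BlockApproves c g) : g < 20 := by
  unfold BlockApproves at h
  split_ifs at h <;> omega

lemma sum_approvers {c : ℕ} (hc : c < 36) (f : ℕ → ℝ) :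
    ∑ i ∈ blockElection.approvers c, f (i / 8) =
      8 * ∑ g ∈ (Finset.range 20).filter (BlockApproves c), f g := by
  rw [blockElection_approvers hc, Finset.sum_filter, Finset.sum_filter]
  exact_mod_cast sum_range_mul_div (fun g => if BlockApproves c g then f g else 0)
    (by norm_num : 0 < 8) 20

lemma sum_approvers_min {c : ℕ} (hc : c < 36) (q t : ℕ) :
    ∑ i ∈ blockElection.approvers c, min ((q : ℝ) / 60) ((blockBudget t (i / 8) : ℝ) / 60) =
      8 * (((∑ g ∈ (Finset.range 20).filter (BlockApproves c),
        min q (blockBudget t g) : ℕ) : ℝ) / 60) := by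
  rw [sum_approvers hc (fun g => min ((q : ℝ) / 60) ((blockBudget t g : ℝ) / 60))]
  push_cast
  rw [Finset.sum_div]
  congr 1
  refine Finset.sum_congr rfl fun g _ => ?_
  rw [min_div_div_right (by norm_num)]

lemma sum_min_blockBudget_self : ∀ t < 20,
    ∑ g ∈ (Finset.range 20).filter (BlockApproves t),
      min (blockPayment t) (blockBudget t g) = 60 := by
  decide +kernel

lemma sum_min_blockBudget_le : ∀ t < 20, ∀ c < 36, t ≤ c →
    ∑ g ∈ (Finset.range 20).filter (BlockApproves c),
      min (blockPayment t) (blockBudget t g) < 60 ∨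
    (∑ g ∈ (Finset.range 20).filter (BlockApproves c),
      min (blockPayment t) (blockBudget t g) = 60 ∧
      ∃ g < 20, BlockApproves c g ∧ blockPayment t ≤ blockBudget t g) := by
  decide +kernel

lemma blockBudget_final : ∀ g < 20, blockBudget 20 g = 0 := by
  decide +kernel

lemma blockPayment_le_of_affordable {t c : ℕ} {q : ℝ} (ht : t < 20)
    (h : Affordable blockElection (fun i => (blockBudget t (i / 8) : ℝ) / 60)
      (Finset.range t) c q) :
    (blockPayment t : ℝ) / 60 ≤ q := by
  obtain ⟨hc, hct, -, hp⟩ := h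
  rw [blockElection_price] at hp
  have hc36 : c < 36 := Finset.mem_range.1 hc
  by_contra! hq
  have hmono : ∀ i ∈ blockElection.approvers c, min q ((blockBudget t (i / 8) : ℝ) / 60) ≤
      min ((blockPayment t : ℝ) / 60) ((blockBudget t (i / 8) : ℝ) / 60) :=
    fun i _ => min_le_min_right _ hq.le
  have hsum := sum_approvers_min hc36 (blockPayment t) t
  rcases sum_min_blockBudget_le t ht c hc36 (by simpa using hct) with hlt | ⟨heq, g, hg, hcg, hb⟩
  · have := Finset.sum_le_sum hmono
    rw [hsum] at this
    have hlt' : ((∑ g ∈ (Finset.range 20).filter (BlockApproves c),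
        min (blockPayment t) (blockBudget t g) : ℕ) : ℝ) < 60 := by exact_mod_cast hlt
    linarith
  · have hb' : (blockPayment t : ℝ) / 60 ≤ (blockBudget t g : ℝ) / 60 := by gcongr
    have hdiv : g * 8 / 8 = g := by omega
    have := Finset.sum_lt_sum hmono ⟨g * 8, mem_blockElection_approvers.2
      ⟨by omega, hc36, by rwa [hdiv]⟩, by
        rw [hdiv, min_eq_left hb', min_eq_left (hq.le.trans hb')]; exact hq⟩
    rw [hsum, heq] at this
    norm_num at this
    linarith

lemma ruleXReach_blockElection : ∀ t ≤ 20,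
    RuleXReach blockElection (fun i => (blockBudget t (i / 8) : ℝ) / 60) (Finset.range t) := by
  intro t
  induction t with
  | zero =>
    intro _
    convert RuleXReach.init (E := blockElection) using 2
    · norm_num [blockBudget]
    · exact Finset.range_zero
  | succ t ih =>
    intro ht
    have ht' : t < 20 := ht
    have hstep := RuleXReach.step (c := t) (q := (blockPayment t : ℝ) / 60) (ih ht'.le)
      ⟨Finset.mem_range.2 (by omega), by simp, by positivity, by
        rw [sum_approvers_min (by omega), sum_min_blockBudget_self t ht', blockElection_price]
        norm_num⟩
      (fun c q h => blockPayment_le_of_affordable ht' h)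
    rw [← Finset.range_add_one] at hstep
    convert hstep using 1
    funext i
    by_cases h : BlockApproves t (i / 8)
    · have hi := h.lt
      rw [if_pos (mem_blockElection_approvers.2 ⟨by omega, by omega, h⟩), blockBudget, if_pos h,
        Nat.cast_sub (min_le_right _ _), Nat.cast_min, min_div_div_right (by norm_num), sub_div]
    · rw [if_neg (fun hm => h (mem_blockElection_approvers.1 hm).2.2), blockBudget, if_neg h]

lemma ruleXOutput_blockElection : RuleXOutput blockElection (Finset.range 20) := by
  refine ⟨_, ruleXReach_blockElection 20 le_rfl, ?_⟩
  rintro c q ⟨-, -, -, hp⟩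
  rw [blockElection_price] at hp
  have : ∑ i ∈ blockElection.approvers c, min q ((blockBudget 20 (i / 8) : ℝ) / 60) ≤ 0 := by
    refine Finset.sum_nonpos fun i hi => (min_le_right _ _).trans ?_
    rw [blockBudget_final _ (by have := (mem_blockElection_approvers.1 hi).1; omega)]
    simp
  linarith

lemma sum_deviationPayment_blocks : ∀ c < 36, 20 ≤ c →
    ∑ g ∈ Finset.range 20, deviationPayment g c = 16 := by
  decide +kernel

lemma sum_deviationPayment_candidates : ∀ g < 20, g < 5 ∨ (7 ≤ g ∧ g < 12) ∨ 14 ≤ g →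
    ∑ c ∈ Finset.Ico 20 36, deviationPayment g c = 16 := by
  decide +kernel

lemma deviationPayment_eq_zero {g c : ℕ} (hc : c ∉ Finset.Ico 20 36) :
    deviationPayment g c = 0 :=
  if_neg fun h => hc (Finset.mem_Ico.2 ⟨h.1, h.2.1⟩)

lemma deviationPayment_le (g c : ℕ) : deviationPayment g c ≤ 2 := by
  unfold deviationPayment
  split_ifs <;> omega

/-- The deviating coalition. -/
def coalition : Finset ℕ := Finset.range 40 ∪ Finset.Ico 56 96 ∪ Finset.Ico 112 160

lemma mem_coalition {i : ℕ} : i ∈ coalition ↔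
    i / 8 < 20 ∧ (i / 8 < 5 ∨ (7 ≤ i / 8 ∧ i / 8 < 12) ∨ 14 ≤ i / 8) := by
  simp only [coalition, Finset.mem_union, Finset.mem_range, Finset.mem_Ico]
  omega

lemma card_coalition : coalition.card = 128 := by
  decide +kernel

lemma coalition_subset : coalition ⊆ Finset.range 160 := fun i hi => by
  have := mem_coalition.1 hi
  rw [Finset.mem_range]
  omega

lemma sum_coalition_deviationPayment {c : ℕ} (hc : c ∈ Finset.Ico 20 36) :
    ∑ i ∈ coalition, (deviationPayment (i / 8) c : ℝ) / 16 = 8 := by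
  rw [Finset.mem_Ico] at hc
  rw [Finset.sum_subset coalition_subset]
  · have h := sum_range_mul_div (fun g => (deviationPayment g c : ℝ) / 16)
      (by norm_num : 0 < 8) 20
    have h16 : ∑ g ∈ Finset.range 20, (deviationPayment g c : ℝ) = 16 := by
      exact_mod_cast sum_deviationPayment_blocks c hc.2 hc.1
    rw [← Finset.sum_div _ fun g => (deviationPayment g c : ℝ), h16] at h
    norm_num at h
    exact h
  · intro i hi hiS
    have : deviationPayment (i / 8) c = 0 := by
      refine if_neg fun h => hiS (mem_coalition.2 ⟨h.2.2.lt, ?_⟩)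
      have happ := h.2.2
      unfold BlockApproves at happ
      split_ifs at happ <;> omega
    simp [this]

lemma sum_deviationPayment_of_mem {i : ℕ} (hi : i ∈ coalition) :
    ∑ c ∈ Finset.Ico 20 36, (deviationPayment (i / 8) c : ℝ) / 16 = 1 := by
  have h := mem_coalition.1 hi
  rw [← Finset.sum_div]
  have h16 : ∑ c ∈ Finset.Ico 20 36, (deviationPayment (i / 8) c : ℝ) = 16 := by
    exact_mod_cast sum_deviationPayment_candidates _ h.1 h.2
  rw [h16]
  norm_num

lemma priceable_deviation (k : ℕ) :
    Priceable { C := blockElection.C, N := coalition, A := blockElection.A, k := k }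
      (Finset.Ico 20 36) := by
  refine ⟨{ p := 8
            pay := fun i c => (deviationPayment (i / 8) c : ℝ) / 16
            p_pos := by norm_num
            pay_nonneg := fun i c => by positivity
            pay_le_one := fun i c => ?_
            pay_approved := fun i _ c h => ?_
            pay_budget := fun i hi => ?_ }, ?_, ?_, ?_⟩
  · have : (deviationPayment (i / 8) c : ℝ) ≤ 2 := by exact_mod_cast deviationPayment_le _ _
    linarith
  · have hne : deviationPayment (i / 8) c ≠ 0 := fun h0 => by simp [h0] at h
    have hc := (ite_ne_right_iff.1 hne).1
    exact Finset.mem_filter.2 ⟨Finset.mem_range.2 hc.2.1, hc.2.2⟩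
  · have hsub : Finset.Ico 20 36 ⊆ Finset.range 36 := fun c hc =>
      Finset.mem_range.2 (Finset.mem_Ico.1 hc).2
    refine le_of_eq ?_
    rw [← sum_deviationPayment_of_mem hi]
    refine (Finset.sum_subset hsub fun c _ hc => ?_).symm
    simp [deviationPayment_eq_zero hc]
  · exact fun c hc => sum_coalition_deviationPayment hc
  · intro c hc
    simp [deviationPayment_eq_zero hc]
  · intro c _ _
    refine (Finset.sum_nonpos fun i hi => ?_).trans (by norm_num : (0 : ℝ) ≤ 8)
    exact (sub_eq_zero.2 (sum_deviationPayment_of_mem (Finset.mem_filter.1 hi).1).symm).le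

lemma card_blockApproves_lt : ∀ g < 20, g < 5 ∨ (7 ≤ g ∧ g < 12) ∨ 14 ≤ g →
    (((Finset.range 36).filter (fun c => BlockApproves c g)) ∩ Finset.range 20).card <
      (((Finset.range 36).filter (fun c => BlockApproves c g)) ∩ Finset.Ico 20 36).card := by
  decide +kernel

/-- Rule X violates the core subject to priceability: there are an
instance `(P,k)`, a committee `W` that Rule X can output, and a pair `(S,T)` with
`|T| ≤ k·|S|/n`, `|A_i ∩ T| > |A_i ∩ W|` for every `i ∈ S`, and `T` priceable in the
restricted instance `(P|_S, |T|)`.  In particular this holds for the paper's instance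
with 160 voters partitioned into `V₁, V₂, V₃` of sizes 56, 56, 48, committee size
`k = 20`, candidate sets `C₁` (20 candidates, the Rule X output) and `C₂`
(16 candidates, the priceable deviation for `S = V₁' ∪ V₂' ∪ V₃`). -/
theorem ruleX_violates_core_subject_to_priceability :
    ∃ (E : Election) (W S T V₁ V₂ V₃ V₁' V₂' C₁ C₂ : Finset ℕ),
      E.Valid ∧ RuleXOutput E W ∧
      S ⊆ E.N ∧ T ⊆ E.C ∧
      T.card * E.N.card ≤ S.card * E.k ∧
      (∀ i ∈ S, (E.A i ∩ W).card < (E.A i ∩ T).card) ∧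
      Priceable { C := E.C, N := S, A := E.A, k := T.card } T ∧
      E.N.card = 160 ∧ E.k = 20 ∧
      V₁.card = 56 ∧ V₂.card = 56 ∧ V₃.card = 48 ∧
      Disjoint V₁ V₂ ∧ Disjoint V₁ V₃ ∧ Disjoint V₂ V₃ ∧
      V₁ ∪ V₂ ∪ V₃ = E.N ∧
      C₁.card = 20 ∧ C₂.card = 16 ∧ Disjoint C₁ C₂ ∧ C₁ ∪ C₂ = E.C ∧
      W = C₁ ∧ T = C₂ ∧
      V₁' ⊆ V₁ ∧ V₂' ⊆ V₂ ∧ V₁'.card = 40 ∧ V₂'.card = 40 ∧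
      S = V₁' ∪ V₂' ∪ V₃ := by
  refine ⟨blockElection, Finset.range 20, coalition, Finset.Ico 20 36,
    Finset.range 56, Finset.Ico 56 112, Finset.Ico 112 160, Finset.range 40, Finset.Ico 56 96,
    Finset.range 20, Finset.Ico 20 36,
    ⟨fun i _ => Finset.filter_subset _ _, by simp [blockElection], by simp [blockElection],
      by simp [blockElection]⟩,
    ruleXOutput_blockElection, coalition_subset,
    fun c hc => Finset.mem_range.2 (Finset.mem_Ico.1 hc).2,
    by simp [blockElection, card_coalition],
    fun i hi => card_blockApproves_lt _ (mem_coalition.1 hi).1 (mem_coalition.1 hi).2,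
    priceable_deviation _, by simp [blockElection], rfl, by simp, by simp, by simp,
    ?_, ?_, ?_, ?_, by simp, by simp, ?_, ?_, rfl, rfl, ?_, ?_, by simp, by simp, rfl⟩
  · rw [Finset.disjoint_left]; intro i; simp only [Finset.mem_range, Finset.mem_Ico]; omega
  · rw [Finset.disjoint_left]; intro i; simp only [Finset.mem_range, Finset.mem_Ico]; omega
  · rw [Finset.disjoint_left]; intro i; simp only [Finset.mem_Ico]; omega
  · ext i; simp only [blockElection, Finset.mem_union, Finset.mem_range, Finset.mem_Ico]; omega
  · rw [Finset.disjoint_left]; intro i; simp only [Finset.mem_range, Finset.mem_Ico]; omega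
  · ext i; simp only [blockElection, Finset.mem_union, Finset.mem_range, Finset.mem_Ico]; omega
  · intro i; simp only [Finset.mem_range]; omega
  · intro i; simp only [Finset.mem_Ico]; omega

end ABC
end

section
/- PAV satisfies the Pigou–Dalton principle: for every election instance (P,k), no committee of size at most k with maximal PAV score admits a Pigou–Dalton transfer. -/
/-!
Common framework for approval-based committee elections
(Peters & Skowron, "Proportionality and the Limits of Welfarism").
-/

namespace ABC

/-- Harmonic sums have decreasing increments: over `d` steps, `hsum` gains strictly more when
started from the smaller argument. -/
theorem hsum_add_lt_hsum_add {a b d : ℕ} (hab : a < b) (hd : 0 < d) :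
    hsum a + hsum (b + d) < hsum (a + d) + hsum b := by
  have h : ∑ x ∈ Finset.range d, (1 : ℝ) / (((b + x : ℕ) : ℝ) + 1)
      < ∑ x ∈ Finset.range d, (1 : ℝ) / (((a + x : ℕ) : ℝ) + 1) := by
    refine Finset.sum_lt_sum_of_nonempty (Finset.nonempty_range_iff.mpr hd.ne') fun x _ => ?_
    refine one_div_lt_one_div_of_lt (by positivity) ?_
    have : (a : ℝ) < b := by exact_mod_cast hab
    push_cast
    linarith
  simp only [hsum, Finset.sum_range_add]
  linarith

/-- PAV satisfies the Pigou–Dalton principle: no committee of size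
at most `k` with maximal PAV score admits a Pigou–Dalton transfer. -/
theorem pav_pigou_dalton (E : Election) (hE : E.Valid)
    (W : Finset ℕ) (hW : PavWinner E W) :
    ¬ AdmitsPD E W := by
  rintro ⟨W', hW'C, hcard, i, hi, j, hj, hij, -, hother, hsum_eq, hj_lt, hle, hi_lt⟩
  refine (hW.2.2 W' hW'C (hcard.trans_le hW.2.1)).not_gt ?_
  have hpair : hsum (E.A i ∩ W).card + hsum (E.A j ∩ W).card
      < hsum (E.A i ∩ W').card + hsum (E.A j ∩ W').card := by
    obtain ⟨d, hd⟩ := Nat.exists_eq_add_of_lt hi_lt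
    have hjd : (E.A j ∩ W).card = (E.A j ∩ W').card + (d + 1) := by omega
    rw [hjd, hd, add_assoc]
    exact hsum_add_lt_hsum_add (hi_lt.trans_le hle) d.succ_pos
  have hj' : j ∈ E.N.erase i := Finset.mem_erase.mpr ⟨hij.symm, hj⟩
  have hrest : ∑ l ∈ (E.N.erase i).erase j, hsum (E.A l ∩ W').card
      = ∑ l ∈ (E.N.erase i).erase j, hsum (E.A l ∩ W).card := by
    refine Finset.sum_congr rfl fun l hl => ?_
    simp only [Finset.mem_erase] at hl
    rw [hother l hl.2.2 hl.2.1 hl.1]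
  simp only [pavScore, ← Finset.add_sum_erase _ _ hi, ← Finset.add_sum_erase _ _ hj']
  linarith

end ABC
end

section
/- The core is incompatible with the Pigou–Dalton principle: in the election instance with 6 voters and 15 candidates where A_1 = {c_1,c_2,c_3,c_4}, A_2 = {c_1,c_2,c_3,c_5}, A_3 = {c_1,c_2,c_3,c_6}, A_4 = {c_7,c_8,c_9}, A_5 = {c_10,c_11,c_12}, A_6 = {c_13,c_14,c_15}, and committee size k = 12, every committee of size 12 that is in the core contains c_1, c_2, c_3 and at least one of c_4, c_5, c_6, and consequently every such committee admits a Pigou–Dalton transfer. -/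
/-!
Common framework for approval-based committee elections
(Peters & Skowron, "Proportionality and the Limits of Welfarism").
-/

namespace ABC

/-- The approval profile of the paper's 6-voter, 15-candidate instance. -/
def A19 : ℕ → Finset ℕ := fun i =>
  if i = 1 then {1, 2, 3, 4}
  else if i = 2 then {1, 2, 3, 5}
  else if i = 3 then {1, 2, 3, 6}
  else if i = 4 then {7, 8, 9}
  else if i = 5 then {10, 11, 12}
  else if i = 6 then {13, 14, 15}
  else ∅

/-- The paper's election instance with 6 voters, 15 candidates and `k = 12`. -/
def E19 : Election :=
  { C := Finset.Icc 1 15, N := Finset.Icc 1 6, A := A19, k := 12 }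

/-- Swapping a candidate `a` approved only by `j` for a candidate `d` approved only by `i` is
a Pigou–Dalton transfer as soon as `j` has at least two more representatives than `i`. -/
theorem admitsPD_of_swap {E : Election} {W : Finset ℕ} {i j a d : ℕ}
    (hWC : W ⊆ E.C) (hdC : d ∈ E.C) (hi : i ∈ E.N) (hj : j ∈ E.N)
    (haW : a ∈ W) (hdW : d ∉ W)
    (ha : ∀ l ∈ E.N, a ∈ E.A l ↔ l = j) (hd : ∀ l ∈ E.N, d ∈ E.A l ↔ l = i)
    (hgap : (E.A i ∩ W).card + 2 ≤ (E.A j ∩ W).card) : AdmitsPD E W := by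
  have hij : i ≠ j := by
    rintro rfl
    omega
  have hda : d ∉ W.erase a := fun h => hdW (Finset.mem_of_mem_erase h)
  have hother : ∀ l ∈ E.N, l ≠ i → l ≠ j →
      (E.A l ∩ insert d (W.erase a)).card = (E.A l ∩ W).card := by
    intro l hl hli hlj
    rw [Finset.inter_insert_of_notMem (mt (hd l hl).1 hli), Finset.inter_erase,
      Finset.erase_eq_of_notMem]
    exact fun h => hlj ((ha l hl).1 (Finset.mem_inter.1 h).1)
  have hgain : (E.A i ∩ insert d (W.erase a)).card = (E.A i ∩ W).card + 1 := by
    rw [Finset.inter_insert_of_mem ((hd i hi).2 rfl), Finset.inter_erase,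
      Finset.erase_eq_of_notMem fun h => hij ((ha i hi).1 (Finset.mem_inter.1 h).1),
      Finset.card_insert_of_notMem fun h => hdW (Finset.mem_inter.1 h).2]
  have hloss : (E.A j ∩ insert d (W.erase a)).card + 1 = (E.A j ∩ W).card := by
    rw [Finset.inter_insert_of_notMem fun h => hij ((hd j hj).1 h).symm, Finset.inter_erase,
      Finset.card_erase_add_one (Finset.mem_inter.2 ⟨(ha j hj).2 rfl, haW⟩)]
  refine ⟨insert d (W.erase a),
    Finset.insert_subset hdC ((Finset.erase_subset _ _).trans hWC), ?_,
    i, hi, j, hj, hij, by omega, hother, by omega, by omega, by omega, by omega⟩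
  rw [Finset.card_insert_of_notMem hda, Finset.card_erase_add_one haW]

/-- In a core committee of `E19`, the whole ballot of one of the first three voters
is elected. -/
theorem exists_ballot_subset_of_inCore {W : Finset ℕ} (hcore : InCore E19 W) :
    ∃ j ∈ ({1, 2, 3} : Finset ℕ), A19 j ⊆ W := by
  by_contra! h
  refine hcore ⟨{1, 2, 3}, Finset.Icc 1 6, by decide, by decide, by decide, by decide, ?_⟩
  intro i hi
  have hT : A19 i ∩ Finset.Icc 1 6 = A19 i := by
    revert i
    decide
  change (A19 i ∩ W).card < (A19 i ∩ Finset.Icc 1 6).card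
  rw [hT]
  exact Finset.card_lt_card
    ⟨Finset.inter_subset_left, fun hs => h i hi (hs.trans Finset.inter_subset_right)⟩

/-- A committee of size 12 containing the ballot of one of the first three voters misses one
of the candidates `7, …, 15`. -/
theorem exists_notMem_of_ballot_subset {W : Finset ℕ} (hWcard : W.card = 12) {j : ℕ}
    (hj : j ∈ ({1, 2, 3} : Finset ℕ)) (hjW : A19 j ⊆ W) :
    ∃ d ∈ Finset.Icc 7 15, d ∉ W := by
  by_contra! h
  have hcard : (A19 j ∪ Finset.Icc 7 15).card = 13 := by
    clear hjW
    revert j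
    decide
  have := Finset.card_le_card (Finset.union_subset hjW h)
  omega

/-- In the instance `E19`, every committee of size 12 that is in the
core contains `c₁, c₂, c₃` and at least one of `c₄, c₅, c₆`, and consequently every
such committee admits a Pigou–Dalton transfer. -/
theorem core_incompatible_with_pigou_dalton (W : Finset ℕ)
    (hWC : W ⊆ E19.C) (hWcard : W.card = 12) (hcore : InCore E19 W) :
    (({1, 2, 3} : Finset ℕ) ⊆ W ∧ (4 ∈ W ∨ 5 ∈ W ∨ 6 ∈ W)) ∧ AdmitsPD E19 W := by
  obtain ⟨j, hj, hjW⟩ := exists_ballot_subset_of_inCore hcore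
  obtain ⟨d, hd, hdW⟩ := exists_notMem_of_ballot_subset hWcard hj hjW
  have hj' : j ∈ Finset.Icc 1 6 ∧ {1, 2, 3} ⊆ A19 j ∧ j + 3 ∈ A19 j ∧
      (j + 3 = 4 ∨ j + 3 = 5 ∨ j + 3 = 6) ∧ (A19 j).card = 4 ∧
      ∀ l ∈ Finset.Icc 1 6, j + 3 ∈ A19 l ↔ l = j := by
    clear hjW
    revert j
    decide
  have hd' : d ∈ Finset.Icc 1 15 ∧ ∃ i ∈ Finset.Icc 1 6, (A19 i).card = 3 ∧
      ∀ l ∈ Finset.Icc 1 6, d ∈ A19 l ↔ l = i := by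
    clear hdW
    revert d
    decide
  obtain ⟨hjN, hcommon, haj, ha, hjcard, haonly⟩ := hj'
  obtain ⟨hdC, i, hiN, hicard, hdonly⟩ := hd'
  have haW : j + 3 ∈ W := hjW haj
  refine ⟨⟨hcommon.trans hjW, ?_⟩, admitsPD_of_swap hWC hdC hiN hjN haW hdW haonly hdonly ?_⟩
  · rcases ha with h | h | h <;> rw [h] at haW <;> simp [haW]
  · have hlt : (A19 i ∩ W).card < (A19 i).card := Finset.card_lt_card
      ⟨Finset.inter_subset_left,
        fun hs => hdW (Finset.mem_inter.1 (hs ((hdonly i hiN).2 rfl))).2⟩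
    change (A19 i ∩ W).card + 2 ≤ (A19 j ∩ W).card
    rw [Finset.inter_eq_left.2 hjW]
    omega

end ABC
end
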